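/- arXiv:1510.01188 — 2 statements merged into one kernel-verified Lean document; each statement's English description precedes it below -/
import Mathlib

section
/- (Main Theorem: the reduced likelihood.) Let n ≥ 1 be an integer, γ, δ real numbers with n > γ + 1 and n > δ + 1, let x̄₁, x̄₂ ∈ ℝ, s₁, s₂ > 0, r ∈ (−1,1), and ρ ∈ (−1,1). Let f(y | μ₁, μ₂, σ₁, σ₂, ρ) denote the bivariate normal likelihood given in the context. Then the quadruple integral ∫₀^∞ ∫₀^∞ ∫_ℝ ∫_ℝ f(y | μ₁, μ₂, σ₁, σ₂, ρ) σ₁^{γ−1} σ₂^{δ−1} dμ₁ dμ₂ dσ₁ dσ₂ equals p_{γ,δ}(y₀) · [ A_{γ,δ}(n, r | ρ) + B_{γ,δ}(n, r | ρ) ], where p_{γ,δ}(y₀) = 2^{(−γ−δ−4)/2} (π^{1−n}/n) (n s₁²)^{(1+γ−n)/2} (n s₂²)^{(1+δ−n)/2} Γ((n−γ−1)/2) Γ((n−δ−1)/2), A_{γ,δ}(n, r | ρ) = (1−ρ²)^{(n−γ−δ−1)/2} ₂F₁((n−γ−1)/2, (n−δ−1)/2; 1/2; r²ρ²), and B_{γ,δ}(n,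 r | ρ) = 2rρ (1−ρ²)^{(n−γ−δ−1)/2} W_{γ,δ}(n) ₂F₁((n−γ)/2, (n−δ)/2; 3/2; r²ρ²). -/
open MeasureTheory Real Set

/-- Pochhammer symbol (rising factorial) `(x)_m`. -/
noncomputable def poch (x : ℝ) (m : ℕ) : ℝ := (ascPochhammer ℝ m).eval x

/-- Confluent hypergeometric function `₁F₁(a; c; z)`. -/
noncomputable def oneF1 (a c z : ℝ) : ℝ :=
  ∑' m : ℕ, poch a m / (poch c m * (m.factorial : ℝ)) * z ^ m

/-- Gauss hypergeometric function `₂F₁(a, b; c; z)`. -/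
noncomputable def twoF1 (a b c z : ℝ) : ℝ :=
  ∑' m : ℕ, poch a m * poch b m / (poch c m * (m.factorial : ℝ)) * z ^ m

/-- Generalized hypergeometric function `₃F₂(a₁, a₂, a₃; b₁, b₂; z)`. -/
noncomputable def threeF2 (a₁ a₂ a₃ b₁ b₂ z : ℝ) : ℝ :=
  ∑' m : ℕ, poch a₁ m * poch a₂ m * poch a₃ m /
      (poch b₁ m * poch b₂ m * (m.factorial : ℝ)) * z ^ m

/-- Beta function `B(u,v) = Γ(u)Γ(v)/Γ(u+v)`. -/
noncomputable def betaFn (u v : ℝ) : ℝ := Real.Gamma u * Real.Gamma v / Real.Gamma (u + v)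

/-- `W_{γ,δ}(n)`, the ratio of Gamma functions from the paper. -/
noncomputable def Wgd (γ δ : ℝ) (n : ℕ) : ℝ :=
  (Real.Gamma (((n : ℝ) - γ) / 2) * Real.Gamma (((n : ℝ) - δ) / 2)) /
    (Real.Gamma (((n : ℝ) - γ - 1) / 2) * Real.Gamma (((n : ℝ) - δ - 1) / 2))

/-- The bivariate normal likelihood for data summarized by `y = (n, x̄₁, x̄₂, s₁, s₂, r)`. -/
noncomputable def biLik (n : ℕ) (x1 x2 s1 s2 r μ1 μ2 σ1 σ2 ρ : ℝ) : ℝ :=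
  (2 * π * σ1 * σ2 * Real.sqrt (1 - ρ ^ 2)) ^ (-(n : ℝ)) *
    Real.exp (-((n : ℝ) / (2 * (1 - ρ ^ 2))) *
      ((x1 - μ1) ^ 2 / σ1 ^ 2 - 2 * ρ * (x1 - μ1) * (x2 - μ2) / (σ1 * σ2) +
        (x2 - μ2) ^ 2 / σ2 ^ 2)) *
    Real.exp (-((n : ℝ) / (2 * (1 - ρ ^ 2))) *
      (s1 ^ 2 / σ1 ^ 2 - 2 * ρ * r * s1 * s2 / (σ1 * σ2) + s2 ^ 2 / σ2 ^ 2))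

lemma rpow_neg_two_substitution (α K : ℝ) {x : ℝ} (hx : x ∈ Ioi (0 : ℝ)) :
    (|(-2 : ℝ)| * x ^ ((-2 : ℝ) - 1)) •
        ((x ^ (-2 : ℝ)) ^ (α - 1) * exp (-(K * x ^ (-2 : ℝ)))) =
      2 * (x ^ (-2 * α - 1) * exp (-(K / x ^ 2))) := by
  have hx' : 0 < x := hx
  have h1 : x ^ (-2 : ℝ) = (x ^ 2)⁻¹ := by
    rw [rpow_neg hx'.le]; norm_cast
  rw [← rpow_mul hx'.le, smul_eq_mul, h1, div_eq_mul_inv,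
    show (-2 * α - 1 : ℝ) = (-2 - 1) + -2 * (α - 1) by ring, rpow_add hx',
    abs_of_neg (by norm_num : (-2 : ℝ) < 0)]
  ring

lemma integrableOn_rpow_mul_exp_neg_div_sq {α K : ℝ} (hα : 0 < α) (hK : 0 < K) :
    IntegrableOn (fun x : ℝ => x ^ (-2 * α - 1) * exp (-(K / x ^ 2))) (Ioi 0) := by
  have h0 : IntegrableOn (fun y : ℝ => y ^ (α - 1) * exp (-(K * y))) (Ioi 0) := by
    have := integrableOn_rpow_mul_exp_neg_mul_rpow (p := 1) (s := α - 1) (b := K)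
      (by linarith) one_pos hK
    simpa using this
  have h1 := (integrableOn_Ioi_comp_rpow_iff (fun y : ℝ => y ^ (α - 1) * exp (-(K * y)))
    (p := -2) (by norm_num)).2 h0
  rw [integrableOn_congr_fun (fun x hx => rpow_neg_two_substitution α K hx)
    measurableSet_Ioi] at h1
  have h2 := h1.const_mul (1 / 2 : ℝ)
  refine h2.congr (Filter.Eventually.of_forall fun x => ?_)
  simp only
  ring

lemma integral_rpow_mul_exp_neg_div_sq {α K : ℝ} (hα : 0 < α) (hK : 0 < K) :
    ∫ x in Ioi (0 : ℝ), x ^ (-2 * α - 1) * exp (-(K / x ^ 2)) =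
      Gamma α / (2 * K ^ α) := by
  have h := integral_comp_rpow_Ioi (fun y : ℝ => y ^ (α - 1) * exp (-(K * y)))
    (p := -2) (by norm_num)
  rw [setIntegral_congr_fun measurableSet_Ioi
    (fun x hx => rpow_neg_two_substitution α K hx), integral_const_mul,
    Real.integral_rpow_mul_exp_neg_mul_Ioi hα hK, one_div, inv_rpow hK.le] at h
  rw [div_eq_mul_inv, mul_inv]
  linarith

lemma integral_exp_neg_mul_bivariate_quadratic {n ρ s t : ℝ} (hn : 0 < n) (hρ : 0 < 1 - ρ ^ 2)
    (hs : 0 < s) (ht : 0 < t) (x y : ℝ) :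
    ∫ v : ℝ, ∫ u : ℝ, exp (-(n / (2 * (1 - ρ ^ 2))) *
      ((x - u) ^ 2 / s ^ 2 - 2 * ρ * (x - u) * (y - v) / (s * t) + (y - v) ^ 2 / t ^ 2)) =
      2 * π * s * t * √(1 - ρ ^ 2) / n := by
  have h1 : ∀ v : ℝ, ∫ u : ℝ, exp (-(n / (2 * (1 - ρ ^ 2))) *
      ((x - u) ^ 2 / s ^ 2 - 2 * ρ * (x - u) * (y - v) / (s * t) + (y - v) ^ 2 / t ^ 2)) =
      √(π / (n / (2 * (1 - ρ ^ 2) * s ^ 2))) * exp (-(n / (2 * t ^ 2)) * (y - v) ^ 2) := by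
    intro v
    rw [← integral_gaussian, ← integral_mul_const,
      ← integral_sub_left_eq_self _ volume (x - ρ * (y - v) * s / t)]
    congr 1
    ext u
    rw [← exp_add]
    congr 1
    field_simp
    ring
  simp_rw [h1]
  rw [integral_const_mul, integral_sub_left_eq_self (fun v => exp (-(n / (2 * t ^ 2)) * v ^ 2)),
    integral_gaussian, ← sqrt_mul (by positivity)]
  rw [show π / (n / (2 * (1 - ρ ^ 2) * s ^ 2)) * (π / (n / (2 * t ^ 2))) =
    (2 * π * s * t / n) ^ 2 * (1 - ρ ^ 2) by field_simp, sqrt_mul (by positivity),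
    sqrt_sq (by positivity)]
  ring

lemma hasSum_integral_inverse_quadratic {a b p q z : ℝ} (ha : 0 < a) (hb : 0 < b)
    (hp : 0 < p) (hq : 0 < q) (hz : |z| < 1) :
    HasSum (fun m : ℕ => (2 * z) ^ m / (m.factorial : ℝ) *
        (Gamma (a + m / 2) * Gamma (b + m / 2)) / (4 * (p ^ 2) ^ a * (q ^ 2) ^ b))
      (∫ τ in Ioi (0 : ℝ), ∫ σ in Ioi (0 : ℝ), σ ^ (-2 * a - 1) * τ ^ (-2 * b - 1) *
        exp (-(p ^ 2 / σ ^ 2 - 2 * z * p * q / (σ * τ) + q ^ 2 / τ ^ 2))) := by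
  set μ : Measure (ℝ × ℝ) := (volume.restrict (Ioi 0)).prod (volume.restrict (Ioi 0)) with hμ
  have hpos : ∀ᵐ x ∂μ, 0 < x.1 ∧ 0 < x.2 := by
    rw [hμ, Measure.prod_restrict]
    filter_upwards [ae_restrict_mem (measurableSet_Ioi.prod measurableSet_Ioi)] with x hx
    exact hx
  let f : ℝ → ℝ × ℝ → ℝ := fun w x => x.2 ^ (-2 * a - 1) * x.1 ^ (-2 * b - 1) *
    exp (-(p ^ 2 / x.2 ^ 2 - 2 * w * p * q / (x.2 * x.1) + q ^ 2 / x.1 ^ 2))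
  let F : ℝ → ℕ → ℝ × ℝ → ℝ := fun w m x => (2 * w * p * q) ^ m / (m.factorial : ℝ) *
    ((x.1 ^ (-2 * (b + m / 2) - 1) * exp (-(q ^ 2 / x.1 ^ 2))) *
      (x.2 ^ (-2 * (a + m / 2) - 1) * exp (-(p ^ 2 / x.2 ^ 2))))
  have hfm : ∀ w, Measurable (f w) := fun w => by fun_prop
  have hFm : ∀ w m, Measurable (F w m) := fun w m => by fun_prop
  have hsum : ∀ w, ∀ x : ℝ × ℝ, 0 < x.1 ∧ 0 < x.2 → HasSum (fun m => F w m x) (f w x) := by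
    rintro w ⟨t, s⟩ ⟨ht, hs⟩
    simp only at ht hs
    have h := (NormedSpace.expSeries_div_hasSum_exp (2 * w * p * q / (s * t))).mul_left
      (s ^ (-2 * a - 1) * t ^ (-2 * b - 1) * exp (-(p ^ 2 / s ^ 2)) * exp (-(q ^ 2 / t ^ 2)))
    rw [← Real.exp_eq_exp_ℝ] at h
    have hF : ∀ m, F w m (t, s) =
        s ^ (-2 * a - 1) * t ^ (-2 * b - 1) * exp (-(p ^ 2 / s ^ 2)) * exp (-(q ^ 2 / t ^ 2)) *
          ((2 * w * p * q / (s * t)) ^ m / (m.factorial : ℝ)) := by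
      intro m
      simp only [F]
      rw [show -2 * (b + (m : ℝ) / 2) - 1 = (-2 * b - 1) - m by ring,
        show -2 * (a + (m : ℝ) / 2) - 1 = (-2 * a - 1) - m by ring,
        rpow_sub_natCast ht.ne', rpow_sub_natCast hs.ne', div_pow, mul_pow s t]
      field_simp
    have hf : f w (t, s) =
        s ^ (-2 * a - 1) * t ^ (-2 * b - 1) * exp (-(p ^ 2 / s ^ 2)) * exp (-(q ^ 2 / t ^ 2)) *
          exp (2 * w * p * q / (s * t)) := by
      simp only [f]
      rw [show ∀ c d e g : ℝ, c * exp d * exp e * exp g = c * exp (d + e + g) by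
        intros; rw [exp_add, exp_add]; ring]
      congr 2
      ring
    simp_rw [hF, hf]
    exact h
  have hfi : ∀ w, 0 ≤ w → w < 1 → Integrable (f w) μ := by
    intro w hw0 hw1
    have hw : 0 < 1 - w := by linarith
    have h := (integrableOn_rpow_mul_exp_neg_div_sq hb
      (show 0 < (1 - w) * q ^ 2 by positivity)).mul_prod
      (integrableOn_rpow_mul_exp_neg_div_sq ha (show 0 < (1 - w) * p ^ 2 by positivity))
    refine Integrable.mono' h (hfm w).aestronglyMeasurable ?_
    filter_upwards [hpos] with x hx
    obtain ⟨t, s⟩ := x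
    obtain ⟨ht, hs⟩ := hx
    simp only at ht hs
    simp only [f]
    rw [Real.norm_of_nonneg (by positivity)]
    rw [show ∀ c d e g : ℝ, c * exp d * (e * exp g) = e * c * exp (d + g) by
      intros; rw [exp_add]; ring]
    gcongr
    have := mul_nonneg hw0 (sq_nonneg (p / s - q / t))
    have e : w * (p / s - q / t) ^ 2 =
      w * (p ^ 2 / s ^ 2) - 2 * w * p * q / (s * t) + w * (q ^ 2 / t ^ 2) := by
      field_simp
      ring
    rw [e] at this
    rw [mul_div_assoc (1 - w), mul_div_assoc (1 - w)]
    linarith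
  have hint : ∀ m, ∫ x, F z m x ∂μ = (2 * z) ^ m / (m.factorial : ℝ) *
        (Gamma (a + m / 2) * Gamma (b + m / 2)) / (4 * (p ^ 2) ^ a * (q ^ 2) ^ b) := by
    intro m
    have hpw : ∀ {y : ℝ} (c : ℝ), 0 < y → (y ^ 2) ^ (c + (m : ℝ) / 2) = (y ^ 2) ^ c * y ^ m := by
      intro y c hy
      rw [rpow_add (by positivity)]
      congr 1
      rw [← rpow_natCast y 2, ← rpow_mul hy.le]
      push_cast
      rw [show (2 : ℝ) * (m / 2) = m by ring, rpow_natCast]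
    simp only [F]
    rw [integral_const_mul, hμ,
      integral_prod_mul (fun t : ℝ => t ^ (-2 * (b + (m : ℝ) / 2) - 1) * exp (-(q ^ 2 / t ^ 2)))
        (fun s : ℝ => s ^ (-2 * (a + (m : ℝ) / 2) - 1) * exp (-(p ^ 2 / s ^ 2))),
      integral_rpow_mul_exp_neg_div_sq (by positivity) (by positivity),
      integral_rpow_mul_exp_neg_div_sq (by positivity) (by positivity), hpw b hq, hpw a hp,
      mul_pow, mul_pow (2 * z)]
    field_simp
    ring
  have hfz : Integrable (f z) μ := by
    refine Integrable.mono' (hfi |z| (abs_nonneg z) hz) (hfm z).aestronglyMeasurable ?_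
    filter_upwards [hpos] with x hx
    obtain ⟨ht, hs⟩ := hx
    simp only [f]
    rw [Real.norm_of_nonneg (by positivity)]
    gcongr
    exact le_abs_self z
  have key := hasSum_integral_of_dominated_convergence (μ := μ) (F := F z) (f := f z)
    (fun m x => F |z| m x) (fun m => (hFm z m).aestronglyMeasurable)
    (fun m => by
      filter_upwards [hpos] with x hx
      obtain ⟨ht, hs⟩ := hx
      simp only [F, norm_mul, norm_div, norm_pow, Real.norm_eq_abs, Nat.abs_cast, abs_exp,
        abs_of_pos (rpow_pos_of_pos ht _), abs_of_pos (rpow_pos_of_pos hs _), abs_of_pos hp,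
        abs_of_pos hq, abs_two, le_refl])
    (by filter_upwards [hpos] with x hx using (hsum |z| x hx).summable)
    ((hfi |z| (abs_nonneg z) hz).congr (by
      filter_upwards [hpos] with x hx using (hsum |z| x hx).tsum_eq.symm))
    (by filter_upwards [hpos] with x hx using hsum z x hx)
  simp_rw [hint] at key
  rwa [hμ, integral_prod _ hfz] at key

lemma Gamma_add_natCast_eq_poch_mul {x : ℝ} (hx : 0 < x) (m : ℕ) :
    Gamma (x + m) = poch x m * Gamma x := by
  induction m with
  | zero => simp [poch]
  | succ m ih =>
    rw [Nat.cast_succ, ← add_assoc, Gamma_add_one (by positivity), ih]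
    simp only [poch, ascPochhammer_succ_eval]
    ring

lemma factorial_two_mul_eq_poch (m : ℕ) :
    ((2 * m).factorial : ℝ) = 4 ^ m * (poch (1 / 2) m * (m.factorial : ℝ)) := by
  induction m with
  | zero => simp [poch]
  | succ m ih =>
    rw [show 2 * (m + 1) = 2 * m + 1 + 1 by ring, Nat.factorial_succ, Nat.factorial_succ,
      Nat.factorial_succ]
    push_cast
    rw [ih]
    simp only [poch, ascPochhammer_succ_eval]
    ring

lemma factorial_two_mul_add_one_eq_poch (m : ℕ) :
    ((2 * m + 1).factorial : ℝ) = 4 ^ m * (poch (3 / 2) m * (m.factorial : ℝ)) := by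
  induction m with
  | zero => simp [poch]
  | succ m ih =>
    rw [show 2 * (m + 1) + 1 = 2 * m + 1 + 1 + 1 by ring, Nat.factorial_succ (2 * m + 1 + 1),
      Nat.factorial_succ (2 * m + 1), Nat.factorial_succ m, Nat.cast_mul, Nat.cast_mul, ih]
    push_cast
    simp only [poch, ascPochhammer_succ_eval]
    ring

lemma tsum_Gamma_series_eq_twoF1 {a b z : ℝ} (ha : 0 < a) (hb : 0 < b)
    (hs : Summable fun m : ℕ => (2 * z) ^ m / (m.factorial : ℝ) *
      (Gamma (a + m / 2) * Gamma (b + m / 2))) :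
    ∑' m : ℕ, (2 * z) ^ m / (m.factorial : ℝ) * (Gamma (a + m / 2) * Gamma (b + m / 2)) =
      Gamma a * Gamma b * twoF1 a b (1 / 2) (z ^ 2) +
      2 * z * (Gamma (a + 1 / 2) * Gamma (b + 1 / 2)) *
        twoF1 (a + 1 / 2) (b + 1 / 2) (3 / 2) (z ^ 2) := by
  obtain ⟨g, hg⟩ : ∃ g : ℕ → ℝ, ∀ m : ℕ, g m = (2 * z) ^ m / (m.factorial : ℝ) *
      (Gamma (a + m / 2) * Gamma (b + m / 2)) := ⟨_, fun _ => rfl⟩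
  simp_rw [← hg] at hs ⊢
  have heven : ∀ m : ℕ, g (2 * m) = Gamma a * Gamma b *
      (poch a m * poch b m / (poch (1 / 2) m * (m.factorial : ℝ)) * (z ^ 2) ^ m) := by
    intro m
    rw [hg, factorial_two_mul_eq_poch, show a + ((2 * m : ℕ) : ℝ) / 2 = a + m by push_cast; ring,
      show b + ((2 * m : ℕ) : ℝ) / 2 = b + m by push_cast; ring,
      Gamma_add_natCast_eq_poch_mul ha, Gamma_add_natCast_eq_poch_mul hb, pow_mul, mul_pow 2 z,
      mul_pow, show (2 : ℝ) ^ 2 = 4 by norm_num, mul_div_mul_left _ _ (by positivity)]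
    ring
  have hodd : ∀ m : ℕ, g (2 * m + 1) = 2 * z * (Gamma (a + 1 / 2) * Gamma (b + 1 / 2)) *
      (poch (a + 1 / 2) m * poch (b + 1 / 2) m / (poch (3 / 2) m * (m.factorial : ℝ)) *
        (z ^ 2) ^ m) := by
    intro m
    rw [hg, factorial_two_mul_add_one_eq_poch,
      show a + ((2 * m + 1 : ℕ) : ℝ) / 2 = a + 1 / 2 + m by push_cast; ring,
      show b + ((2 * m + 1 : ℕ) : ℝ) / 2 = b + 1 / 2 + m by push_cast; ring,
      Gamma_add_natCast_eq_poch_mul (by positivity), Gamma_add_natCast_eq_poch_mul (by positivity),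
      pow_succ, pow_mul, mul_pow 2 z, mul_pow, show (2 : ℝ) ^ 2 = 4 by norm_num,
      mul_assoc (4 ^ m), mul_div_mul_left _ _ (by positivity)]
    ring
  rw [← tsum_even_add_odd
    (hs.comp_injective (i := fun k : ℕ => 2 * k) fun _ _ h => by simpa using h)
    (hs.comp_injective (i := fun k : ℕ => 2 * k + 1) fun _ _ h => by simpa using h)]
  simp_rw [heven, hodd, tsum_mul_left, twoF1]

lemma integral_inverse_quadratic_eq_twoF1 {a b p q z : ℝ} (ha : 0 < a) (hb : 0 < b)
    (hp : 0 < p) (hq : 0 < q) (hz : |z| < 1) :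
    ∫ τ in Ioi (0 : ℝ), ∫ σ in Ioi (0 : ℝ), σ ^ (-2 * a - 1) * τ ^ (-2 * b - 1) *
        exp (-(p ^ 2 / σ ^ 2 - 2 * z * p * q / (σ * τ) + q ^ 2 / τ ^ 2)) =
      (Gamma a * Gamma b * twoF1 a b (1 / 2) (z ^ 2) +
        2 * z * (Gamma (a + 1 / 2) * Gamma (b + 1 / 2)) *
          twoF1 (a + 1 / 2) (b + 1 / 2) (3 / 2) (z ^ 2)) / (4 * (p ^ 2) ^ a * (q ^ 2) ^ b) := by
  have h := hasSum_integral_inverse_quadratic ha hb hp hq hz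
  have hd : (4 * (p ^ 2) ^ a * (q ^ 2) ^ b) ≠ 0 := by positivity
  rw [← h.tsum_eq, tsum_div_const, tsum_Gamma_series_eq_twoF1 ha hb]
  exact (summable_div_const_iff hd).1 h.summable

lemma integral_biLik_means {n : ℕ} (hn : 1 ≤ n) {ρ σ1 σ2 : ℝ} (hρ : 0 < 1 - ρ ^ 2)
    (hσ1 : 0 < σ1) (hσ2 : 0 < σ2) (γ δ x1 x2 s1 s2 r : ℝ) :
    ∫ μ2 : ℝ, ∫ μ1 : ℝ,
        biLik n x1 x2 s1 s2 r μ1 μ2 σ1 σ2 ρ * σ1 ^ (γ - 1) * σ2 ^ (δ - 1) =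
      (2 * π * √(1 - ρ ^ 2)) ^ (1 - (n : ℝ)) / n *
        (σ1 ^ (γ - n) * σ2 ^ (δ - n) * exp (-((n : ℝ) / (2 * (1 - ρ ^ 2))) *
          (s1 ^ 2 / σ1 ^ 2 - 2 * ρ * r * s1 * s2 / (σ1 * σ2) + s2 ^ 2 / σ2 ^ 2))) := by
  have hn' : (0 : ℝ) < n := by exact_mod_cast hn
  have hd : 0 < √(1 - ρ ^ 2) := sqrt_pos.2 hρ
  simp only [biLik, integral_mul_const, integral_const_mul]
  rw [integral_exp_neg_mul_bivariate_quadratic hn' hρ hσ1 hσ2]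
  have h1 : (2 * π * σ1 * σ2 * √(1 - ρ ^ 2)) ^ (-(n : ℝ)) *
      (2 * π * σ1 * σ2 * √(1 - ρ ^ 2)) =
      (2 * π * √(1 - ρ ^ 2)) ^ (1 - (n : ℝ)) * σ1 ^ (1 - (n : ℝ)) * σ2 ^ (1 - (n : ℝ)) := by
    rw [← rpow_add_one (by positivity), ← mul_rpow (by positivity) (by positivity),
      ← mul_rpow (by positivity) (by positivity)]
    congr 1 <;> ring
  rw [show γ - (n : ℝ) = (1 - n) + (γ - 1) by ring, show δ - (n : ℝ) = (1 - n) + (δ - 1) by ring,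
    rpow_add hσ1, rpow_add hσ2, ← mul_div_assoc, h1]
  ring

lemma reduced_likelihood_constant {n d u v γ δ : ℝ} (hn : 0 < n) (hd : 0 < d)
    (hu : 0 < u) (hv : 0 < v) :
    (2 * π * √d) ^ (1 - n) / n /
        (4 * (n / (2 * d) * u) ^ ((n - γ - 1) / 2) * (n / (2 * d) * v) ^ ((n - δ - 1) / 2)) =
      (2 : ℝ) ^ ((-γ - δ - 4) / 2) * (π ^ (1 - n) / n) * (n * u) ^ ((1 + γ - n) / 2) *
        (n * v) ^ ((1 + δ - n) / 2) * d ^ ((n - γ - δ - 1) / 2) := by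
  have hpi := pi_pos
  have hpow : ∀ w ε : ℝ, 0 < w → (n / (2 * d) * w) ^ ((n - ε - 1) / 2) =
      ((n * w) ^ ((1 + ε - n) / 2) * (2 ^ ((n - ε - 1) / 2) * d ^ ((n - ε - 1) / 2)))⁻¹ := by
    intro w ε hw
    rw [show n / (2 * d) * w = n * w / (2 * d) by ring, div_rpow (by positivity) (by positivity),
      mul_rpow zero_le_two hd.le, show (1 + ε - n) / 2 = -((n - ε - 1) / 2) by ring,
      rpow_neg (by positivity : 0 ≤ n * w), mul_inv, inv_inv, div_eq_mul_inv]
  rw [hpow u γ hu, hpow v δ hv, sqrt_eq_rpow, mul_rpow (by positivity) (by positivity),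
    mul_rpow (by positivity) (by positivity), ← rpow_mul hd.le]
  have h2 : (2 : ℝ) ^ ((-γ - δ - 4) / 2) =
      2 ^ (1 - n) * 2 ^ ((n - γ - 1) / 2) * 2 ^ ((n - δ - 1) / 2) / 4 := by
    rw [show (-γ - δ - 4) / 2 = 1 - n + (n - γ - 1) / 2 + (n - δ - 1) / 2 - 2 by ring,
      rpow_sub two_pos, rpow_add two_pos, rpow_add two_pos]
    norm_num
  have h3 : d ^ ((n - γ - δ - 1) / 2) =
      d ^ (1 / 2 * (1 - n)) * d ^ ((n - γ - 1) / 2) * d ^ ((n - δ - 1) / 2) := by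
    rw [← rpow_add hd, ← rpow_add hd]
    congr 1
    ring
  rw [h2, h3]
  simp only [div_eq_mul_inv, mul_inv, inv_inv]
  ring

/-- Main theorem: the likelihood times the prior, with `(μ₁, μ₂, σ₁, σ₂)` integrated out,
factors as `p_{γ,δ}(y₀) · [A_{γ,δ}(n, r | ρ) + B_{γ,δ}(n, r | ρ)]`. -/
theorem reduced_likelihood (n : ℕ) (hn : 1 ≤ n) (γ δ : ℝ)
    (hγ : γ + 1 < (n : ℝ)) (hδ : δ + 1 < (n : ℝ)) (x1 x2 : ℝ) (s1 s2 : ℝ)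
    (hs1 : 0 < s1) (hs2 : 0 < s2) (r : ℝ) (hr : r ∈ Ioo (-1 : ℝ) 1)
    (ρ : ℝ) (hρ : ρ ∈ Ioo (-1 : ℝ) 1) :
    (∫ σ2 in Ioi (0 : ℝ), ∫ σ1 in Ioi (0 : ℝ), ∫ μ2 : ℝ, ∫ μ1 : ℝ,
        biLik n x1 x2 s1 s2 r μ1 μ2 σ1 σ2 ρ * σ1 ^ (γ - 1) * σ2 ^ (δ - 1)) =
      ((2 : ℝ) ^ ((-γ - δ - 4) / 2) * (π ^ (1 - (n : ℝ)) / (n : ℝ)) *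
          ((n : ℝ) * s1 ^ 2) ^ ((1 + γ - (n : ℝ)) / 2) *
          ((n : ℝ) * s2 ^ 2) ^ ((1 + δ - (n : ℝ)) / 2) *
          Real.Gamma (((n : ℝ) - γ - 1) / 2) * Real.Gamma (((n : ℝ) - δ - 1) / 2)) *
        ((1 - ρ ^ 2) ^ (((n : ℝ) - γ - δ - 1) / 2) *
            twoF1 (((n : ℝ) - γ - 1) / 2) (((n : ℝ) - δ - 1) / 2) (1 / 2) (r ^ 2 * ρ ^ 2) +
          2 * r * ρ * (1 - ρ ^ 2) ^ (((n : ℝ) - γ - δ - 1) / 2) * Wgd γ δ n *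
            twoF1 (((n : ℝ) - γ) / 2) (((n : ℝ) - δ) / 2) (3 / 2) (r ^ 2 * ρ ^ 2)) := by
  have hn' : (0 : ℝ) < n := by exact_mod_cast hn
  have hd : 0 < 1 - ρ ^ 2 := by
    rw [sub_pos, sq_lt_one_iff_abs_lt_one, abs_lt]
    exact hρ
  have hz : |r * ρ| < 1 := by
    rw [abs_mul]
    exact mul_lt_one_of_nonneg_of_lt_one_left (abs_nonneg _) (abs_lt.2 hr) (abs_lt.2 hρ).le
  have ha : 0 < ((n : ℝ) - γ - 1) / 2 := by linarith
  have hb : 0 < ((n : ℝ) - δ - 1) / 2 := by linarith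
  set k : ℝ := n / (2 * (1 - ρ ^ 2)) with hk
  have hk0 : 0 < k := by positivity
  have hsq : ∀ s : ℝ, (√k * s) ^ 2 = k * s ^ 2 := fun s => by rw [mul_pow, sq_sqrt hk0.le]
  have hmain := integral_inverse_quadratic_eq_twoF1 ha hb
    (mul_pos (sqrt_pos.2 hk0) hs1) (mul_pos (sqrt_pos.2 hk0) hs2) hz
  have hcongr : (∫ σ2 in Ioi (0 : ℝ), ∫ σ1 in Ioi (0 : ℝ), ∫ μ2 : ℝ, ∫ μ1 : ℝ,
        biLik n x1 x2 s1 s2 r μ1 μ2 σ1 σ2 ρ * σ1 ^ (γ - 1) * σ2 ^ (δ - 1)) =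
      (2 * π * √(1 - ρ ^ 2)) ^ (1 - (n : ℝ)) / n *
      ∫ τ in Ioi (0 : ℝ), ∫ σ in Ioi (0 : ℝ), σ ^ (-2 * (((n : ℝ) - γ - 1) / 2) - 1) *
        τ ^ (-2 * (((n : ℝ) - δ - 1) / 2) - 1) *
        exp (-((√k * s1) ^ 2 / σ ^ 2 - 2 * (r * ρ) * (√k * s1) * (√k * s2) / (σ * τ) +
          (√k * s2) ^ 2 / τ ^ 2)) := by
    rw [← integral_const_mul]
    refine setIntegral_congr_fun measurableSet_Ioi fun τ hτ => ?_
    rw [← integral_const_mul]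
    refine setIntegral_congr_fun measurableSet_Ioi fun σ hσ => ?_
    rw [integral_biLik_means hn hd hσ hτ, ← hk, hsq, hsq,
      show -2 * (((n : ℝ) - γ - 1) / 2) - 1 = γ - n by ring,
      show -2 * (((n : ℝ) - δ - 1) / 2) - 1 = δ - n by ring,
      show 2 * (r * ρ) * (√k * s1) * (√k * s2) = 2 * (r * ρ) * (√k * √k) * s1 * s2 by ring,
      mul_self_sqrt hk0.le]
    congr 3
    ring
  rw [hcongr, hmain, hsq, hsq, hk, mul_div_left_comm,
    reduced_likelihood_constant hn' hd (by positivity) (by positivity), Wgd,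
    show ((n : ℝ) - γ - 1) / 2 + 1 / 2 = (n - γ) / 2 by ring,
    show ((n : ℝ) - δ - 1) / 2 + 1 / 2 = (n - δ) / 2 by ring, mul_pow]
  have hGa := (Gamma_pos_of_pos ha).ne'
  have hGb := (Gamma_pos_of_pos hb).ne'
  field_simp
end

section
/- (Corollary 1, even moments.) Let n ≥ 1 be an integer, let α > 0, β ≥ 0, γ, δ be real numbers with n > γ + δ − 2α + 1, let r ∈ (−1,1), and let k ≥ 0 be an even integer. Then ∫_{−1}^{1} ρ^k (1−ρ²)^{(2α+n−γ−δ−3)/2} (1+ρ²)^{β/2} ₂F₁((n−γ−1)/2, (n−δ−1)/2; 1/2; r²ρ²) dρ = Σ_{m=0}^∞ [ ((n−γ−1)/2)_m ((n−δ−1)/2)_m / ((1/2)_m m!) ] a_{k,m} r^{2m}, where a_{k,m} = B( (k+2m+1)/2, α + (n−γ−δ−1)/2 ) · ₂F₁( −β/2, (k+2m+1)/2; (k+2m+2α+n−γ−δ)/2; −1 ), and the series on the right converges. -/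
open MeasureTheory Real Set

theorem poch_zero (x : ℝ) : poch x 0 = 1 := by simp [poch]

theorem poch_succ (x : ℝ) (m : ℕ) : poch x (m + 1) = poch x m * (x + m) :=
  ascPochhammer_succ_eval m x

theorem poch_pos {x : ℝ} (hx : 0 < x) (m : ℕ) : 0 < poch x m := ascPochhammer_pos m x hx

theorem Gamma_add_natCast {x : ℝ} (hx : 0 < x) (m : ℕ) :
    Real.Gamma (x + m) = poch x m * Real.Gamma x := by
  induction m with
  | zero => simp [poch_zero]
  | succ m ih =>
    rw [poch_succ, Nat.cast_succ, ← add_assoc, Real.Gamma_add_one (by positivity), ih]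
    ring

theorem betaFn_add_natCast {u v : ℝ} (hu : 0 < u) (hv : 0 < v) (j : ℕ) :
    betaFn (u + j) v = betaFn u v * (poch u j / poch (u + v) j) := by
  have hG := (Real.Gamma_pos_of_pos (add_pos hu hv)).ne'
  have hP := (poch_pos (add_pos hu hv) j).ne'
  rw [betaFn, betaFn, show u + j + v = u + v + j by ring, Gamma_add_natCast hu,
    Gamma_add_natCast (add_pos hu hv)]
  field_simp

theorem hasSum_one_sub_rpow (a : ℝ) {z : ℝ} (hz : |z| < 1) :
    HasSum (fun j : ℕ => poch a j / (j.factorial : ℝ) * z ^ j) ((1 - z) ^ (-a)) := by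
  have h := (Real.one_div_one_sub_rpow_hasFPowerSeriesOnBall_zero a).hasSum (y := z)
    (by simpa [Metric.mem_eball, edist_dist, ← ENNReal.ofReal_one] using! hz)
  have hz' : 0 ≤ 1 - z := by linarith [(abs_lt.mp hz).2]
  simp only [zero_add, one_div, ← Real.rpow_neg hz'] at h
  convert! h using 2 with j
  have hc : Ring.choose (a + j - 1) j = poch a j / (j.factorial : ℝ) := by
    have := Ring.factorial_nsmul_multichoose_eq_ascPochhammer a j
    rw [Polynomial.ascPochhammer_smeval_eq_eval, nsmul_eq_mul] at this
    rw [Ring.choose, poch, ← this]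
    have := Nat.cast_ne_zero (R := ℝ).mpr j.factorial_ne_zero
    field_simp
    congr 1
    ring
  simp [hc, mul_comm]

theorem summable_abs_poch_neg_div_factorial {p : ℝ} (hp : 0 ≤ p) :
    Summable (fun j : ℕ => |poch (-p) j / (j.factorial : ℝ)|) := by
  set t : ℕ → ℝ := fun j => |poch (-p) j / (j.factorial : ℝ)| with ht
  rcases hp.eq_or_lt with rfl | hp
  · refine summable_of_ne_finset_zero (s := {0}) fun j hj => ?_
    obtain ⟨i, rfl⟩ := Nat.exists_eq_succ_of_ne_zero (by simpa using hj)
    have : poch 0 (i + 1) = 0 := by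
      induction i with
      | zero => simp [poch_succ]
      | succ i ih => rw [poch_succ, ih (by simp), zero_mul]
    simp [ht, this]
  have hstep (j : ℕ) (hj : p ≤ j) : (j + 1) * t (j + 1) = (j - p) * t j := by
    simp only [ht]
    rw [poch_succ, Nat.factorial_succ, abs_div, abs_div, abs_mul,
      abs_of_nonneg (show 0 ≤ -p + j by linarith)]
    push_cast
    rw [abs_of_pos (by positivity : (0 : ℝ) < (j + 1) * j.factorial),
      abs_of_pos (by positivity : (0 : ℝ) < j.factorial)]
    field_simp
    ring
  obtain ⟨N, hN⟩ := exists_nat_ge p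
  rw [← summable_nat_add_iff N]
  refine summable_of_sum_range_le (c := N * t N / p) (fun _ => abs_nonneg _) fun n => ?_
  have key : p * ∑ i ∈ Finset.range n, t (i + N) = N * t N - ((n + N : ℕ) : ℝ) * t (n + N) := by
    induction n with
    | zero => simp
    | succ n ih =>
      have := hstep (n + N) (hN.trans (by norm_cast; omega))
      rw [Finset.sum_range_succ, mul_add, ih, show n + 1 + N = n + N + 1 by ring]
      push_cast at this ⊢
      linarith
  rw [le_div_iff₀ hp, mul_comm, key]
  have : 0 ≤ ((n + N : ℕ) : ℝ) * t (n + N) := mul_nonneg (Nat.cast_nonneg _) (abs_nonneg _)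
  linarith

theorem integral_rpow_mul_one_sub_rpow {u v : ℝ} (hu : 0 < u) (hv : 0 < v) :
    IntegrableOn (fun t : ℝ => t ^ (u - 1) * (1 - t) ^ (v - 1)) (Ioo 0 1) ∧
      ∫ t in Ioo (0 : ℝ) 1, t ^ (u - 1) * (1 - t) ^ (v - 1) = betaFn u v := by
  have hB : 0 < betaFn u v := ProbabilityTheory.beta_pos hu hv
  have h1 := ProbabilityTheory.lintegral_betaPDF_eq_one hu hv
  rw [ProbabilityTheory.lintegral_betaPDF] at h1
  set f : ℝ → ℝ := fun t => 1 / betaFn u v * t ^ (u - 1) * (1 - t) ^ (v - 1) with hf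
  have hnn : 0 ≤ᵐ[volume.restrict (Ioo 0 1)] f := by
    filter_upwards [ae_restrict_mem measurableSet_Ioo] with t ht
    have := ht.1
    have : 0 < 1 - t := by linarith [ht.2]
    simp only [hf, Pi.zero_apply]
    positivity
  have hmeas : AEStronglyMeasurable f (volume.restrict (Ioo 0 1)) := by
    apply Measurable.aestronglyMeasurable
    fun_prop
  have hint : Integrable f (volume.restrict (Ioo 0 1)) := by
    refine ⟨hmeas, ?_⟩
    rw [hasFiniteIntegral_iff_ofReal hnn]
    exact h1.trans_lt ENNReal.one_lt_top
  have hval : ∫ t in Ioo (0 : ℝ) 1, f t = 1 := by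
    rw [integral_eq_lintegral_of_nonneg_ae hnn hmeas]
    exact congrArg ENNReal.toReal h1
  have heq : (fun t : ℝ => t ^ (u - 1) * (1 - t) ^ (v - 1)) = fun t => betaFn u v * f t := by
    ext t
    simp only [hf]
    field_simp
  rw [heq]
  exact ⟨hint.const_mul _, by rw [integral_const_mul, hval, mul_one]⟩

theorem integral_rpow_mul_one_sub_rpow_mul_one_add_rpow {u v p : ℝ} (hu : 0 < u) (hv : 0 < v)
    (hp : 0 ≤ p) :
    IntegrableOn (fun t : ℝ => t ^ (u - 1) * (1 - t) ^ (v - 1) * (1 + t) ^ p) (Ioo 0 1) ∧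
      ∫ t in Ioo (0 : ℝ) 1, t ^ (u - 1) * (1 - t) ^ (v - 1) * (1 + t) ^ p =
        betaFn u v * twoF1 (-p) u (u + v) (-1) := by
  obtain ⟨hI, hIv⟩ := integral_rpow_mul_one_sub_rpow hu hv
  refine ⟨(hI.mul_const (2 ^ p)).mono' (by apply Measurable.aestronglyMeasurable; fun_prop) ?_, ?_⟩
  · filter_upwards [ae_restrict_mem measurableSet_Ioo] with t ht
    have h0 := ht.1
    have h1 : 0 < 1 - t := by linarith [ht.2]
    rw [Real.norm_of_nonneg (by positivity)]
    gcongr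
    linarith
  set c : ℕ → ℝ := fun j => poch (-p) j / (j.factorial : ℝ) with hc
  set F : ℕ → ℝ → ℝ := fun j t => c j * (-1) ^ j * (t ^ (u + j - 1) * (1 - t) ^ (v - 1)) with hF
  have hu' (j : ℕ) : 0 < u + j := by positivity
  have hFi (j : ℕ) : Integrable (F j) (volume.restrict (Ioo 0 1)) :=
    (integral_rpow_mul_one_sub_rpow (hu' j) hv).1.const_mul _
  have hFv (j : ℕ) : ∫ t in Ioo (0 : ℝ) 1, F j t =
      betaFn u v * (poch (-p) j * poch u j / (poch (u + v) j * (j.factorial : ℝ)) * (-1) ^ j) := by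
    rw [integral_const_mul, (integral_rpow_mul_one_sub_rpow (hu' j) hv).2,
      betaFn_add_natCast hu hv]
    have := (poch_pos (add_pos hu hv) j).ne'
    simp only [hc]
    field_simp
  have hFn (j : ℕ) : ∫ t in Ioo (0 : ℝ) 1, ‖F j t‖ ≤ |c j| * betaFn u v := by
    rw [← hIv, ← integral_const_mul]
    refine setIntegral_mono_on (hFi j).norm (hI.const_mul _) measurableSet_Ioo fun t ht => ?_
    have h0 := ht.1
    have h1 : 0 < 1 - t := by linarith [ht.2]
    simp only [hF, norm_mul, norm_pow, norm_neg, norm_one, one_pow, mul_one, Real.norm_eq_abs]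
    rw [abs_of_pos (Real.rpow_pos_of_pos h0 _), abs_of_pos (Real.rpow_pos_of_pos h1 _)]
    gcongr ?_ * (?_ * _)
    refine Real.rpow_le_rpow_of_exponent_ge h0 ht.2.le ?_
    linarith [(Nat.cast_nonneg j : (0 : ℝ) ≤ j)]
  have hsum : Summable fun j => ∫ t in Ioo (0 : ℝ) 1, ‖F j t‖ :=
    .of_nonneg_of_le (fun j => integral_nonneg fun _ => norm_nonneg _) hFn
      ((summable_abs_poch_neg_div_factorial hp).mul_right _)
  have h := hasSum_integral_of_summable_integral_norm hFi hsum
  simp only [hFv] at h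
  rw [twoF1, ← tsum_mul_left, h.tsum_eq]
  refine setIntegral_congr_fun measurableSet_Ioo fun t ht => ?_
  have hb := (hasSum_one_sub_rpow (-p) (z := -t)
    (by rw [abs_neg, abs_of_pos ht.1]; exact ht.2)).mul_left (t ^ (u - 1) * (1 - t) ^ (v - 1))
  rw [sub_neg_eq_add, neg_neg] at hb
  rw [← hb.tsum_eq]
  refine tsum_congr fun j => ?_
  simp only [hF, hc]
  rw [show u + j - 1 = u - 1 + j by ring, Real.rpow_add ht.1, Real.rpow_natCast, neg_pow t]
  ring

theorem integral_Ioo_comp_sq {g : ℝ → ℝ} (hg : IntegrableOn g (Ioo 0 1)) :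
    IntegrableOn (fun x : ℝ => 2 * x * g (x ^ 2)) (Ioo 0 1) ∧
      ∫ x in Ioo (0 : ℝ) 1, 2 * x * g (x ^ 2) = ∫ t in Ioo (0 : ℝ) 1, g t := by
  have himg : (fun x : ℝ => x ^ 2) '' Ioo 0 1 = Ioo 0 1 := by
    ext y
    constructor
    · rintro ⟨x, ⟨h0, h1⟩, rfl⟩
      exact ⟨by positivity, by simp only []; nlinarith⟩
    · rintro ⟨h0, h1⟩
      exact ⟨√y, ⟨Real.sqrt_pos.mpr h0, by rw [Real.sqrt_lt' one_pos]; simpa using h1⟩,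
        Real.sq_sqrt h0.le⟩
  have hder : ∀ x ∈ Ioo (0 : ℝ) 1,
      HasDerivWithinAt (fun x : ℝ => x ^ 2) (2 * x) (Ioo 0 1) x := fun x _ => by
    simpa using (hasDerivAt_pow 2 x).hasDerivWithinAt
  have hinj : InjOn (fun x : ℝ => x ^ 2) (Ioo 0 1) := fun x hx y hy hxy =>
    (pow_left_inj₀ hx.1.le hy.1.le two_ne_zero).mp hxy
  have hcongr : EqOn (fun x : ℝ => |2 * x| • g (x ^ 2)) (fun x => 2 * x * g (x ^ 2))
      (Ioo 0 1) := fun x hx => by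
    have := hx.1
    simp only [smul_eq_mul]
    rw [abs_of_pos (by positivity)]
  have hi := integrableOn_image_iff_integrableOn_abs_deriv_smul measurableSet_Ioo hder hinj g
  have hv := integral_image_eq_integral_abs_deriv_smul measurableSet_Ioo hder hinj g
  rw [himg] at hi hv
  rw [setIntegral_congr_fun measurableSet_Ioo hcongr] at hv
  exact ⟨(hi.mp hg).congr_fun hcongr measurableSet_Ioo, hv.symm⟩

theorem integral_Ioo_neg_one_one_of_even {f : ℝ → ℝ} (hf : ∀ x, f (-x) = f x)
    (hi : IntegrableOn f (Ioo 0 1)) :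
    IntegrableOn f (Ioo (-1) 1) ∧
      ∫ x in Ioo (-1 : ℝ) 1, f x = 2 * ∫ x in Ioo (0 : ℝ) 1, f x := by
  have h01 : IntervalIntegrable f volume 0 1 := by
    rwa [intervalIntegrable_iff_integrableOn_Ioo_of_le zero_le_one]
  have hneg : IntervalIntegrable f volume (-1) 0 := by
    have := (IntervalIntegrable.iff_comp_neg (f := f)).mp h01
    simp only [hf, neg_zero] at this
    exact this.symm
  have hval : ∫ x in (-1 : ℝ)..0, f x = ∫ x in (0 : ℝ)..1, f x := by
    have := intervalIntegral.integral_comp_neg (a := -1) (b := 0) f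
    simpa [hf] using this
  refine ⟨(intervalIntegrable_iff_integrableOn_Ioo_of_le (by norm_num)).mp (hneg.trans h01), ?_⟩
  rw [← integral_Ioc_eq_integral_Ioo, ← integral_Ioc_eq_integral_Ioo,
    ← intervalIntegral.integral_of_le (by norm_num), ← intervalIntegral.integral_of_le zero_le_one,
    ← intervalIntegral.integral_add_adjacent_intervals hneg h01, hval, two_mul]

theorem integral_even_pow_mul_weight {v p : ℝ} (hv : 0 < v) (hp : 0 ≤ p) {k : ℕ} (hk : Even k) :
    IntegrableOn (fun x : ℝ => x ^ k * (1 - x ^ 2) ^ (v - 1) * (1 + x ^ 2) ^ p) (Ioo (-1) 1) ∧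
      ∫ x in Ioo (-1 : ℝ) 1, x ^ k * (1 - x ^ 2) ^ (v - 1) * (1 + x ^ 2) ^ p =
        betaFn (((k : ℝ) + 1) / 2) v *
          twoF1 (-p) (((k : ℝ) + 1) / 2) (((k : ℝ) + 1) / 2 + v) (-1) := by
  obtain ⟨hi, hiv⟩ := integral_rpow_mul_one_sub_rpow_mul_one_add_rpow
    (show 0 < ((k : ℝ) + 1) / 2 by positivity) hv hp
  obtain ⟨hs, hsv⟩ := integral_Ioo_comp_sq hi
  have hcongr : EqOn (fun x : ℝ => 2 * x * ((x ^ 2) ^ (((k : ℝ) + 1) / 2 - 1) *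
      (1 - x ^ 2) ^ (v - 1) * (1 + x ^ 2) ^ p))
      (fun x => 2 * (x ^ k * (1 - x ^ 2) ^ (v - 1) * (1 + x ^ 2) ^ p)) (Ioo 0 1) := fun x hx => by
    have hpow : x * (x ^ 2) ^ (((k : ℝ) + 1) / 2 - 1) = x ^ k := by
      rw [← Real.rpow_natCast x 2, ← Real.rpow_mul hx.1.le]
      nth_rw 1 [← Real.rpow_one x]
      rw [← Real.rpow_add hx.1, ← Real.rpow_natCast x k]
      congr 1
      push_cast
      ring
    simp only [← hpow]
    ring
  have hs' := (hs.congr_fun hcongr measurableSet_Ioo).const_mul (1 / 2)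
  obtain ⟨he, hev⟩ := integral_Ioo_neg_one_one_of_even
    (f := fun x : ℝ => x ^ k * (1 - x ^ 2) ^ (v - 1) * (1 + x ^ 2) ^ p)
    (fun x => by simp only [hk.neg_pow, even_two.neg_pow])
    (hs'.congr (.of_forall fun x => by ring))
  refine ⟨he, ?_⟩
  rw [hev, ← integral_const_mul, ← hiv, ← hsv]
  exact (setIntegral_congr_fun measurableSet_Ioo hcongr).symm

theorem summable_norm_twoF1_term (a b : ℝ) {c z : ℝ} (hc : 0 < c) (hz : |z| < 1) :
    Summable (fun m : ℕ => ‖poch a m * poch b m / (poch c m * (m.factorial : ℝ)) * z ^ m‖) := by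
  obtain ⟨q, hzq, hq⟩ := exists_between hz
  have hlin (x y : ℝ) : Filter.Tendsto (fun m : ℕ => (x + m) / (y + m)) Filter.atTop (nhds 1) := by
    simpa using tendsto_add_mul_div_add_mul_atTop_nhds x y 1 (one_ne_zero (α := ℝ))
  have hlim : Filter.Tendsto (fun m : ℕ => |(a + m) / (c + m) * ((b + m) / (1 + m)) * z|)
      Filter.atTop (nhds |z|) := by
    simpa using (((hlin a c).mul (hlin b 1)).mul_const z).abs
  refine summable_of_ratio_norm_eventually_le hq ?_
  filter_upwards [hlim.eventually (gt_mem_nhds hzq)] with m hm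
  rw [norm_norm, norm_norm]
  have hP := (poch_pos hc m).ne'
  have hcm : c + m ≠ 0 := by positivity
  have : poch a (m + 1) * poch b (m + 1) / (poch c (m + 1) * ((m + 1).factorial : ℝ)) *
      z ^ (m + 1) = ((a + m) / (c + m) * ((b + m) / (1 + m)) * z) *
        (poch a m * poch b m / (poch c m * (m.factorial : ℝ)) * z ^ m) := by
    rw [poch_succ, poch_succ, poch_succ, Nat.factorial_succ]
    push_cast
    have : (1 : ℝ) + m ≠ 0 := by positivity
    rw [add_comm (m : ℝ) 1]
    rw [pow_succ]
    field_simp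
  rw [this, norm_mul]
  gcongr
  exact hm.le

/-- Corollary 1, even moments: the unnormalized even posterior moment integral equals a
convergent series in `r²`. -/
theorem posterior_moment_even (n : ℕ) (hn : 1 ≤ n) (α β γ δ : ℝ) (hα : 0 < α) (hβ : 0 ≤ β)
    (hcond : γ + δ - 2 * α + 1 < (n : ℝ)) (r : ℝ) (hr : r ∈ Ioo (-1 : ℝ) 1)
    (k : ℕ) (hk : Even k) :
    (∫ ρ in Ioo (-1 : ℝ) 1,
        ρ ^ k * (1 - ρ ^ 2) ^ ((2 * α + (n : ℝ) - γ - δ - 3) / 2) * (1 + ρ ^ 2) ^ (β / 2) *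
          twoF1 (((n : ℝ) - γ - 1) / 2) (((n : ℝ) - δ - 1) / 2) (1 / 2) (r ^ 2 * ρ ^ 2)) =
        (∑' m : ℕ,
          poch (((n : ℝ) - γ - 1) / 2) m * poch (((n : ℝ) - δ - 1) / 2) m /
              (poch (1 / 2) m * (m.factorial : ℝ)) *
            (betaFn (((k : ℝ) + 2 * m + 1) / 2) (α + ((n : ℝ) - γ - δ - 1) / 2) *
              twoF1 (-β / 2) (((k : ℝ) + 2 * m + 1) / 2)
                (((k : ℝ) + 2 * m + 2 * α + (n : ℝ) - γ - δ) / 2) (-1)) *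
            r ^ (2 * m)) ∧
      Summable (fun m : ℕ =>
        poch (((n : ℝ) - γ - 1) / 2) m * poch (((n : ℝ) - δ - 1) / 2) m /
            (poch (1 / 2) m * (m.factorial : ℝ)) *
          (betaFn (((k : ℝ) + 2 * m + 1) / 2) (α + ((n : ℝ) - γ - δ - 1) / 2) *
            twoF1 (-β / 2) (((k : ℝ) + 2 * m + 1) / 2)
              (((k : ℝ) + 2 * m + 2 * α + (n : ℝ) - γ - δ) / 2) (-1)) *
          r ^ (2 * m)) := by
  set a := ((n : ℝ) - γ - 1) / 2
  set b := ((n : ℝ) - δ - 1) / 2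
  set v := α + ((n : ℝ) - γ - δ - 1) / 2 with hv_def
  have hv : 0 < v := by linarith
  have hp : 0 ≤ β / 2 := by positivity
  have hexp : (2 * α + (n : ℝ) - γ - δ - 3) / 2 = v - 1 := by rw [hv_def]; ring
  rw [hexp]
  set A : ℕ → ℝ := fun m => poch a m * poch b m / (poch (1 / 2) m * (m.factorial : ℝ)) with hA
  set w : ℝ → ℝ := fun ρ => (1 - ρ ^ 2) ^ (v - 1) * (1 + ρ ^ 2) ^ (β / 2) with hw
  have hr2 : |r ^ 2| < 1 := by
    rw [abs_of_nonneg (sq_nonneg r), sq_lt_one_iff_abs_lt_one]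
    exact abs_lt.mpr hr
  set F : ℕ → ℝ → ℝ := fun m ρ => A m * (r ^ 2) ^ m * (ρ ^ (k + 2 * m) * w ρ) with hF
  have hmom (m : ℕ) := integral_even_pow_mul_weight hv hp (hk.add (even_two_mul m))
  simp only [mul_assoc _ (_ ^ (v - 1))] at hmom
  have hFi (m : ℕ) : Integrable (F m) (volume.restrict (Ioo (-1) 1)) := (hmom m).1.const_mul _
  have hFv (m : ℕ) : ∫ ρ in Ioo (-1 : ℝ) 1, F m ρ =
      A m * (betaFn (((k : ℝ) + 2 * m + 1) / 2) v *
        twoF1 (-β / 2) (((k : ℝ) + 2 * m + 1) / 2)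
          (((k : ℝ) + 2 * m + 2 * α + (n : ℝ) - γ - δ) / 2) (-1)) * r ^ (2 * m) := by
    have hc : ((k : ℝ) + 2 * m + 2 * α + (n : ℝ) - γ - δ) / 2 =
        ((k : ℝ) + 2 * m + 1) / 2 + v := by rw [hv_def]; ring
    have hval := (hmom m).2
    push_cast at hval
    rw [integral_const_mul, hval, hc, neg_div, pow_mul]
    ring
  have hw0 : Integrable w (volume.restrict (Ioo (-1) 1)) := by
    simpa [hw, IntegrableOn] using (integral_even_pow_mul_weight hv hp (k := 0) Even.zero).1
  have hFn (m : ℕ) : ∫ ρ in Ioo (-1 : ℝ) 1, ‖F m ρ‖ ≤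
      ‖A m * (r ^ 2) ^ m‖ * ∫ ρ in Ioo (-1 : ℝ) 1, ‖w ρ‖ := by
    rw [← integral_const_mul]
    refine setIntegral_mono_on (hFi m).norm (hw0.norm.const_mul _) measurableSet_Ioo
      fun ρ hρ => ?_
    rw [norm_mul, norm_mul (ρ ^ (k + 2 * m))]
    gcongr
    rw [norm_pow]
    exact mul_le_of_le_one_left (norm_nonneg _)
      (pow_le_one₀ (norm_nonneg _) (abs_lt.mpr hρ).le)
  have hsum : Summable fun m => ∫ ρ in Ioo (-1 : ℝ) 1, ‖F m ρ‖ :=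
    .of_nonneg_of_le (fun m => integral_nonneg fun _ => norm_nonneg _) hFn
      ((summable_norm_twoF1_term a b one_half_pos hr2).mul_right _)
  have h := hasSum_integral_of_summable_integral_norm hFi hsum
  simp only [hFv] at h
  refine ⟨?_, h.summable⟩
  rw [h.tsum_eq]
  refine integral_congr_ae (.of_forall fun ρ => ?_)
  simp only [twoF1]
  rw [← tsum_mul_left]
  refine tsum_congr fun m => ?_
  simp only [hF, hA, hw]
  rw [mul_pow, pow_add, pow_mul ρ]
  ring
end
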